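/- arXiv:1610.05950 — 2 statements merged into one kernel-verified Lean document; each statement's English description precedes it below -/
import Mathlib

section
/- Let (s_n) be a sequence of positive reals converging to zero. Let X and Y be separable metric spaces, k_x and k_y bounded continuous symmetric positive semidefinite kernels on X and Y, and k_xy the product kernel k_xy((x,y),(x',y')) := k_x(x,x')·k_y(y,y'). Let P be a probability measure on X, Q a probability measure on Y, and (P̂_n), (Q̂_n) sequences of finite signed Borel measures on X and Y respectively. If √(E_{k_x}(P̂_n − P)) = O(s_n) and √(E_{k_y}(Q̂_n − Q)) = O(s_n) as n → ∞, then √(E_{k_xy}(P̂_n ⊗ Q̂_n − P ⊗ Q)) = O(s_n). -/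
open MeasureTheory Filter Topology Asymptotics

/-- Integral of a real-valued function against a finite signed measure,
defined via the Jordan decomposition. -/
noncomputable def sintegral {X : Type*} [MeasurableSpace X]
    (ν : SignedMeasure X) (g : X → ℝ) : ℝ :=
  (∫ x, g x ∂ν.toJordanDecomposition.posPart) -
    (∫ x, g x ∂ν.toJordanDecomposition.negPart)

/-- The kernel energy `E_k(ν) = ∬ k(x,x') dν(x) dν(x')` of a finite signed measure. -/
noncomputable def energy {X : Type*} [MeasurableSpace X]
    (k : X × X → ℝ) (ν : SignedMeasure X) : ℝ :=
  sintegral ν fun x => sintegral ν fun y => k (x, y)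

/-- The product `μ ⊗ ν` of two finite signed measures, defined via the Jordan
decompositions: `(μ⁺⊗ν⁺ + μ⁻⊗ν⁻) − (μ⁺⊗ν⁻ + μ⁻⊗ν⁺)`. -/
noncomputable def sprod {X Y : Type*} [MeasurableSpace X] [MeasurableSpace Y]
    (μ : SignedMeasure X) (ν : SignedMeasure Y) : SignedMeasure (X × Y) :=
  ((μ.toJordanDecomposition.posPart.prod ν.toJordanDecomposition.posPart).toSignedMeasure +
      (μ.toJordanDecomposition.negPart.prod ν.toJordanDecomposition.negPart).toSignedMeasure) -
    ((μ.toJordanDecomposition.posPart.prod ν.toJordanDecomposition.negPart).toSignedMeasure +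
      (μ.toJordanDecomposition.negPart.prod ν.toJordanDecomposition.posPart).toSignedMeasure)

theorem aux_feature {X : Type*} (k : X × X → ℝ) (hsymm : ∀ a b, k (a, b) = k (b, a))
    (hpsd : ∀ (m : ℕ) (x : Fin m → X) (c : Fin m → ℝ),
      0 ≤ ∑ i, ∑ j, c i * c j * k (x i, x j)) :
    ∃ (K : Matrix X X (ℝ →L[ℝ] ℝ)) (_ : Fact K.PosSemidef) (φ : X → RKHS.OfKernel K),
      ∀ x y, inner ℝ (φ x) (φ y) = k (x, y) := by
  let K : Matrix X X (ℝ →L[ℝ] ℝ) := fun x y => k (x, y) • ContinuousLinearMap.id ℝ ℝ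
  have hK : K.PosSemidef := by
    have h02 := (RKHS.posSemidef_tfae (K := K)).out 0 2
    refine h02.mpr ⟨?_, ?_⟩
    · ext x y
      rw [Matrix.conjTranspose_apply, ContinuousLinearMap.star_eq_adjoint]
      have h1 := ContinuousLinearMap.adjoint_inner_left (K y x) (1 : ℝ) (1 : ℝ)
      simpa [K, hsymm x y] using h1
    · intro v
      have h := hpsd v.support.card (fun i => (v.support.equivFin.symm i : X))
        (fun i => v (v.support.equivFin.symm i))
      refine le_of_le_of_eq h ?_
      simp only [Finsupp.sum, RCLike.re_to_real]
      rw [← Finset.sum_coe_sort v.support, ← v.support.equivFin.symm.sum_comp]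
      refine Finset.sum_congr rfl fun i _ => ?_
      rw [← Finset.sum_coe_sort v.support, ← v.support.equivFin.symm.sum_comp]
      refine Finset.sum_congr rfl fun j _ => ?_
      simp only [K, _root_.smul_apply, ContinuousLinearMap.id_apply, smul_eq_mul]
      rw [hsymm]
      simp
      ring
  have : Fact K.PosSemidef := ⟨hK⟩
  refine ⟨K, ⟨hK⟩, fun x => RKHS.kerFun (RKHS.OfKernel K) x (1 : ℝ), fun x y => ?_⟩
  rw [← RKHS.kernel_inner, RKHS.OfKernel.kernel_ofKernel]
  simp [K, hsymm x y]

/-- vector valued integral against a signed measure -/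
noncomputable def vint {X : Type*} [MeasurableSpace X] {E : Type*} [NormedAddCommGroup E]
    [NormedSpace ℝ E] (ν : SignedMeasure X) (g : X → E) : E :=
  (∫ x, g x ∂ν.toJordanDecomposition.posPart) -
    (∫ x, g x ∂ν.toJordanDecomposition.negPart)

theorem vint_of_sub {X : Type*} [MeasurableSpace X] {E : Type*} [NormedAddCommGroup E]
    [NormedSpace ℝ E] (ν : SignedMeasure X) (g : X → E)
    (hg : ∀ (μ : Measure X) [IsFiniteMeasure μ], Integrable g μ)
    (A B : Measure X) [IsFiniteMeasure A] [IsFiniteMeasure B]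
    (h : ν = A.toSignedMeasure - B.toSignedMeasure) :
    vint ν g = ∫ x, g x ∂A - ∫ x, g x ∂B := by
  have h1 := ν.toSignedMeasure_toJordanDecomposition
  have h1 := h1.trans h
  rw [JordanDecomposition.toSignedMeasure] at h1
  have h2 : ν.toJordanDecomposition.posPart + B = A + ν.toJordanDecomposition.negPart := by
    rw [← Measure.toSignedMeasure_eq_toSignedMeasure_iff, Measure.toSignedMeasure_add, Measure.toSignedMeasure_add]
    exact sub_eq_sub_iff_add_eq_add.mp h1
  have h3 := congrArg (fun μ => ∫ x, g x ∂μ) h2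
  rw [integral_add_measure (hg _) (hg _), integral_add_measure (hg _) (hg _)] at h3
  rw [vint, sub_eq_sub_iff_add_eq_add, h3]

theorem vint_sub {X : Type*} [MeasurableSpace X] {E : Type*} [NormedAddCommGroup E]
    [NormedSpace ℝ E] (μ ν : SignedMeasure X) (g : X → E)
    (hg : ∀ (μ : Measure X) [IsFiniteMeasure μ], Integrable g μ) :
    vint (μ - ν) g = vint μ g - vint ν g := by
  rw [vint_of_sub (μ - ν) g hg
    (μ.toJordanDecomposition.posPart + ν.toJordanDecomposition.negPart)
    (μ.toJordanDecomposition.negPart + ν.toJordanDecomposition.posPart)]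
  · rw [integral_add_measure (hg _) (hg _), integral_add_measure (hg _) (hg _), vint, vint]
    abel
  · conv_lhs => rw [← μ.toSignedMeasure_toJordanDecomposition,
      ← ν.toSignedMeasure_toJordanDecomposition]
    rw [Measure.toSignedMeasure_add, Measure.toSignedMeasure_add,
      JordanDecomposition.toSignedMeasure, JordanDecomposition.toSignedMeasure]
    abel

theorem sintegral_sprod {X Y : Type*} [MeasurableSpace X] [MeasurableSpace Y]
    (μ : SignedMeasure X) (ν : SignedMeasure Y) (f : X → ℝ) (g : Y → ℝ)
    (hfg : ∀ (μ : Measure (X × Y)) [IsFiniteMeasure μ],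
      Integrable (fun p : X × Y => f p.1 * g p.2) μ) :
    sintegral (sprod μ ν) (fun p => f p.1 * g p.2) = sintegral μ f * sintegral ν g := by
  change vint _ _ = _
  rw [sprod, ← Measure.toSignedMeasure_add, ← Measure.toSignedMeasure_add,
    vint_of_sub _ _ hfg _ _ rfl]
  rw [integral_add_measure (hfg _) (hfg _), integral_add_measure (hfg _) (hfg _)]
  simp only [integral_prod_mul, sintegral]
  ring

theorem sintegral_inner {X : Type*} [MeasurableSpace X] {E : Type*} [NormedAddCommGroup E]
    [InnerProductSpace ℝ E] [CompleteSpace E] (ν : SignedMeasure X) (g : X → E)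
    (hg : ∀ (μ : Measure X) [IsFiniteMeasure μ], Integrable g μ) (v : E) :
    sintegral ν (fun x => inner ℝ v (g x)) = inner ℝ v (vint ν g) := by
  rw [sintegral, vint, integral_inner (hg _), integral_inner (hg _), inner_sub_right]

theorem feature_integrable {X : Type*} [MetricSpace X] [TopologicalSpace.SeparableSpace X]
    [MeasurableSpace X] [BorelSpace X] {E : Type*} [NormedAddCommGroup E]
    [InnerProductSpace ℝ E] (k : X × X → ℝ) (hb : ∃ M, ∀ p, |k p| ≤ M) (hc : Continuous k)
    (φ : X → E) (hφ : ∀ x y, inner ℝ (φ x) (φ y) = k (x, y)) :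
    Continuous φ ∧ (∃ C, ∀ x, ‖φ x‖ ≤ C) ∧
      ∀ (μ : Measure X) [IsFiniteMeasure μ], Integrable φ μ := by
  have : SecondCountableTopology X := UniformSpace.secondCountable_of_separable X
  obtain ⟨M, hM⟩ := hb
  have hcont : Continuous φ := by
    rw [continuous_iff_continuousAt]
    intro x
    rw [ContinuousAt, tendsto_iff_norm_sub_tendsto_zero]
    have h1 : ∀ y, ‖φ y - φ x‖ = √(k (y, y) - 2 * k (y, x) + k (x, x)) := by
      intro y
      rw [← hφ, ← hφ, ← hφ, real_inner_self_eq_norm_sq, real_inner_self_eq_norm_sq,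
        ← norm_sub_sq_real, Real.sqrt_sq (norm_nonneg _)]
    simp only [h1]
    have h2 : Continuous fun y => √(k (y, y) - 2 * k (y, x) + k (x, x)) := by fun_prop
    have := h2.tendsto x
    convert this using 2
    symm
    rw [Real.sqrt_eq_zero']
    linarith
  have hbd : ∀ x, ‖φ x‖ ≤ √M := by
    intro x
    apply Real.le_sqrt_of_sq_le
    rw [← real_inner_self_eq_norm_sq, hφ]
    exact (le_abs_self _).trans (hM _)
  refine ⟨hcont, ⟨_, hbd⟩, fun μ _ => ?_⟩
  exact Integrable.of_bound hcont.aestronglyMeasurable _ (Eventually.of_forall hbd)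

theorem energy_eq {X : Type*} [MeasurableSpace X] {E : Type*} [NormedAddCommGroup E]
    [InnerProductSpace ℝ E] [CompleteSpace E] (k : X × X → ℝ) (φ : X → E)
    (hφ : ∀ x y, inner ℝ (φ x) (φ y) = k (x, y))
    (hg : ∀ (μ : Measure X) [IsFiniteMeasure μ], Integrable φ μ) (ν : SignedMeasure X) :
    energy k ν = ‖vint ν φ‖ ^ 2 := by
  simp only [energy, ← hφ, sintegral_inner _ _ hg]
  simp only [real_inner_comm (vint ν φ), sintegral_inner _ _ hg]
  rw [real_inner_self_eq_norm_sq]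

theorem energy_prod {X Y : Type*}
    [MetricSpace X] [TopologicalSpace.SeparableSpace X] [MeasurableSpace X] [BorelSpace X]
    [MetricSpace Y] [TopologicalSpace.SeparableSpace Y] [MeasurableSpace Y] [BorelSpace Y]
    {E F : Type*} [NormedAddCommGroup E] [InnerProductSpace ℝ E] [CompleteSpace E]
    [NormedAddCommGroup F] [InnerProductSpace ℝ F] [CompleteSpace F]
    (φ : X → E) (ψ : Y → F) (hφc : Continuous φ) (hψc : Continuous ψ)
    (hφb : ∃ C, ∀ x, ‖φ x‖ ≤ C) (hψb : ∃ C, ∀ x, ‖ψ x‖ ≤ C)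
    (hφi : ∀ (μ : Measure X) [IsFiniteMeasure μ], Integrable φ μ)
    (hψi : ∀ (μ : Measure Y) [IsFiniteMeasure μ], Integrable ψ μ)
    (a p : SignedMeasure X) (b q : SignedMeasure Y) :
    energy (fun z : (X × Y) × (X × Y) =>
      inner ℝ (φ z.1.1) (φ z.2.1) * inner ℝ (ψ z.1.2) (ψ z.2.2)) (sprod a b - sprod p q) =
    ‖vint a φ‖ ^ 2 * ‖vint b ψ‖ ^ 2 - 2 * (inner ℝ (vint a φ) (vint p φ) *
      inner ℝ (vint b ψ) (vint q ψ)) + ‖vint p φ‖ ^ 2 * ‖vint q ψ‖ ^ 2 := by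
  have : SecondCountableTopology X := UniformSpace.secondCountable_of_separable X
  have : SecondCountableTopology Y := UniformSpace.secondCountable_of_separable Y
  have key : ∀ (u : E) (v : F) (μ : Measure (X × Y)) [IsFiniteMeasure μ],
      Integrable (fun z : X × Y => inner ℝ u (φ z.1) * inner ℝ v (ψ z.2)) μ := by
    intro u v μ _
    obtain ⟨C, hC⟩ := hφb
    obtain ⟨D, hD⟩ := hψb
    refine Integrable.of_bound (C := (‖u‖ * C) * (‖v‖ * D)) ?_ (Eventually.of_forall fun z => ?_)
    · have : Continuous (fun z : X × Y => inner ℝ u (φ z.1) * inner ℝ v (ψ z.2)) := by fun_prop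
      exact this.aestronglyMeasurable
    · rw [norm_mul]
      have h1 : ‖inner ℝ u (φ z.1)‖ ≤ ‖u‖ * C :=
        (norm_inner_le_norm _ _).trans (by gcongr; exact hC _)
      have h2 : ‖inner ℝ v (ψ z.2)‖ ≤ ‖v‖ * D :=
        (norm_inner_le_norm _ _).trans (by gcongr; exact hD _)
      exact mul_le_mul h1 h2 (norm_nonneg _) ((norm_nonneg _).trans h1)
  have hS : ∀ (u : E) (v : F) (m : SignedMeasure X) (n : SignedMeasure Y),
      sintegral (sprod m n) (fun z : X × Y => inner ℝ u (φ z.1) * inner ℝ v (ψ z.2)) =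
        inner ℝ u (vint m φ) * inner ℝ v (vint n ψ) := by
    intro u v m n
    rw [sintegral_sprod m n (fun x => inner ℝ u (φ x)) (fun y => inner ℝ v (ψ y)) (key u v),
      sintegral_inner _ _ hφi, sintegral_inner _ _ hψi]
  have hD : ∀ g : X × Y → ℝ, (∀ (μ : Measure (X × Y)) [IsFiniteMeasure μ], Integrable g μ) →
      sintegral (sprod a b - sprod p q) g = sintegral (sprod a b) g - sintegral (sprod p q) g :=
    fun g hg => vint_sub _ _ g hg
  have hSub : ∀ (g h : X × Y → ℝ) (ν : SignedMeasure (X × Y)),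
      (∀ (μ : Measure (X × Y)) [IsFiniteMeasure μ], Integrable g μ) →
      (∀ (μ : Measure (X × Y)) [IsFiniteMeasure μ], Integrable h μ) →
      sintegral ν (fun z => g z - h z) = sintegral ν g - sintegral ν h := by
    intro g h ν hg hh
    simp only [sintegral]
    rw [integral_sub (hg _) (hh _), integral_sub (hg _) (hh _)]
    ring
  have hin : ∀ x : X × Y, sintegral (sprod a b - sprod p q)
      (fun z => inner ℝ (φ x.1) (φ z.1) * inner ℝ (ψ x.2) (ψ z.2)) =
      inner ℝ (vint a φ) (φ x.1) * inner ℝ (vint b ψ) (ψ x.2) -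
      inner ℝ (vint p φ) (φ x.1) * inner ℝ (vint q ψ) (ψ x.2) := by
    intro x
    rw [hD _ (key _ _), hS, hS, real_inner_comm, real_inner_comm (ψ x.2),
      real_inner_comm (φ x.1), real_inner_comm (ψ x.2)]
    simp only [real_inner_comm]
  rw [energy]
  simp only [hin]
  rw [hSub _ _ _ (key _ _) (key _ _), hD _ (key _ _), hD _ (key _ _), hS, hS, hS, hS]
  simp only [real_inner_self_eq_norm_sq]
  rw [real_inner_comm (vint a φ) (vint p φ), real_inner_comm (vint b ψ) (vint q ψ)]
  ring

theorem alg_bound {E F : Type*} [NormedAddCommGroup E] [InnerProductSpace ℝ E]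
    [NormedAddCommGroup F] [InnerProductSpace ℝ F] (u u0 : E) (v v0 : F) :
    √(‖u‖ ^ 2 * ‖v‖ ^ 2 - 2 * (inner ℝ u u0 * inner ℝ v v0) + ‖u0‖ ^ 2 * ‖v0‖ ^ 2) ≤
      ‖u - u0‖ * ‖v - v0‖ + ‖u - u0‖ * ‖v0‖ + ‖u0‖ * ‖v - v0‖ := by
  apply Real.sqrt_le_iff.mpr ⟨by positivity, ?_⟩
  obtain ⟨a, rfl⟩ : ∃ a, u = a + u0 := ⟨u - u0, by simp⟩
  obtain ⟨b, rfl⟩ : ∃ b, v = b + v0 := ⟨v - v0, by simp⟩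
  simp only [add_sub_cancel_right, norm_add_sq_real, inner_add_left, real_inner_self_eq_norm_sq]
  have h1 := abs_real_inner_le_norm a u0
  have h2 := abs_real_inner_le_norm b v0
  have h3 : inner ℝ a u0 * inner ℝ b v0 ≤ (‖a‖ * ‖u0‖) * (‖b‖ * ‖v0‖) := by
    refine (le_abs_self _).trans ?_
    rw [abs_mul]
    exact mul_le_mul h1 h2 (abs_nonneg _) (by positivity)
  have h4 := mul_le_mul_of_nonneg_left ((le_abs_self _).trans h2) (sq_nonneg ‖a‖)
  have h5 := mul_le_mul_of_nonneg_left ((le_abs_self _).trans h1) (sq_nonneg ‖b‖)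
  nlinarith

/-- Lemma 3 of the paper: `O(s_n)` rates of convergence of the marginal mean-embedding
estimators transfer to the tensor-product estimator of the joint embedding under a
product kernel (RKHS distances expressed as square roots of kernel energies). -/
theorem rate_transfer_to_product_embedding
    {X Y : Type*}
    [MetricSpace X] [TopologicalSpace.SeparableSpace X] [MeasurableSpace X] [BorelSpace X]
    [MetricSpace Y] [TopologicalSpace.SeparableSpace Y] [MeasurableSpace Y] [BorelSpace Y]
    (s : ℕ → ℝ) (hs_pos : ∀ n, 0 < s n) (hs_lim : Tendsto s atTop (𝓝 0))
    (kx : X × X → ℝ) (hkx_bdd : ∃ M, ∀ p, |kx p| ≤ M) (hkx_cont : Continuous kx)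
    (hkx_symm : ∀ a b, kx (a, b) = kx (b, a))
    (hkx_psd : ∀ (m : ℕ) (x : Fin m → X) (c : Fin m → ℝ),
      0 ≤ ∑ i, ∑ j, c i * c j * kx (x i, x j))
    (ky : Y × Y → ℝ) (hky_bdd : ∃ M, ∀ p, |ky p| ≤ M) (hky_cont : Continuous ky)
    (hky_symm : ∀ a b, ky (a, b) = ky (b, a))
    (hky_psd : ∀ (m : ℕ) (y : Fin m → Y) (c : Fin m → ℝ),
      0 ≤ ∑ i, ∑ j, c i * c j * ky (y i, y j))
    (P : Measure X) [IsProbabilityMeasure P] (Q : Measure Y) [IsProbabilityMeasure Q]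
    (Phat : ℕ → SignedMeasure X) (Qhat : ℕ → SignedMeasure Y)
    (hP : (fun n => Real.sqrt (energy kx (Phat n - P.toSignedMeasure))) =O[atTop] s)
    (hQ : (fun n => Real.sqrt (energy ky (Qhat n - Q.toSignedMeasure))) =O[atTop] s) :
    (fun n => Real.sqrt (energy
        (fun p : (X × Y) × (X × Y) => kx (p.1.1, p.2.1) * ky (p.1.2, p.2.2))
        (sprod (Phat n) (Qhat n) - sprod P.toSignedMeasure Q.toSignedMeasure)))
      =O[atTop] s := by
  obtain ⟨Kx, hKx, φ, hφ⟩ := aux_feature kx hkx_symm hkx_psd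
  obtain ⟨Ky, hKy, ψ, hψ⟩ := aux_feature ky hky_symm hky_psd
  obtain ⟨hφc, hφb, hφi⟩ := feature_integrable kx hkx_bdd hkx_cont φ hφ
  obtain ⟨hψc, hψb, hψi⟩ := feature_integrable ky hky_bdd hky_cont ψ hψ
  simp only [energy_eq kx φ hφ hφi, Real.sqrt_sq (norm_nonneg _), vint_sub _ _ _ hφi] at hP
  simp only [energy_eq ky ψ hψ hψi, Real.sqrt_sq (norm_nonneg _), vint_sub _ _ _ hψi] at hQ
  simp only [← hφ, ← hψ, energy_prod φ ψ hφc hψc hφb hψb hφi hψi]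
  have hs1 : s =O[atTop] (fun _ => (1 : ℝ)) := hs_lim.isBigO_one ℝ
  have hPQ := hP.mul (hQ.trans hs1)
  have hPc := hP.mul (isBigO_refl (fun _ : ℕ => ‖vint Q.toSignedMeasure ψ‖) atTop)
  have t1 := (hPQ.congr_right (fun n => mul_one (s n)))
  have t2 := hP.mul (isBigO_const_const ‖vint Q.toSignedMeasure ψ‖ (one_ne_zero (α := ℝ)) atTop)
  have t3 := (isBigO_const_const ‖vint P.toSignedMeasure φ‖ (one_ne_zero (α := ℝ)) atTop).mul hQ
  simp only [mul_one, one_mul] at t2 t3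
  refine IsBigO.trans (isBigO_of_le _ fun n => ?_) ((t1.add t2).add t3)
  rw [Real.norm_of_nonneg (Real.sqrt_nonneg _)]
  exact (alg_bound _ _ _ _).trans (le_abs_self _)
end

section
/- Let X, Y, Z be compact metric spaces, f : X × Y → Z continuous, k_z a continuous symmetric kernel on Z, and k_x, k_y bounded continuous symmetric positive semidefinite kernels on X, Y, whose product kernel k_xy((x,y),(x',y')) := k_x(x,x')·k_y(y,y') has the following property: for every constant C' > 0 and every sequence (ρ_n) of finite signed Borel measures on X × Y with ‖ρ_n‖_TV ≤ C' and E_{k_xy}(ρ_n) → 0, one has ∫ g dρ_n → 0 for every continuous g : X × Y → ℝ. Let P and Q be probability measures on X and Y, and for each n let {(x_{n,i}, w_{n,i})}_{i=1}^{m_n} and {(y_{n,j}, u_{n,j})}_{j=1}^{m_n} be weighted samples with Σ_i |w_{n,i}| ≤ C and Σ_j |u_{n,j}| ≤ C for some constant C independent of n. Set P̂_n := Σ_i w_{n,i} δ_{x_{n,i}} and Q̂_n := Σ_j u_{n,j} δ_{y_{n,j}}. If E_{k_x}(P̂_n − P) → 0 and E_{k_y}(Q̂_n − Q) → 0, then E_{k_z}(ρ_n)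 → 0, where ρ_n := Σ_{i,j} w_{n,i} u_{n,j} δ_{f(x_{n,i}, y_{n,j})} − f_*(P ⊗ Q) is the error of the estimator μ̂₃ = Σ_{i,j} w_{n,i} u_{n,j} k_z(f(x_{n,i}, y_{n,j}), ·) of the embedding of f(X,Y) for independent X ∼ P and Y ∼ Q. -/
open MeasureTheory Filter Topology

open scoped ENNReal NNReal

theorem aux_sintegral_sub {A : Type*} [MeasurableSpace A] (p q : Measure A)
    [IsFiniteMeasure p] [IsFiniteMeasure q] (g : A → ℝ) (hp : Integrable g p)
    (hq : Integrable g q) :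
    sintegral (p.toSignedMeasure - q.toSignedMeasure) g = (∫ x, g x ∂p) - ∫ x, g x ∂q := by
  unfold sintegral
  rw [Measure.toJordanDecomposition_toSignedMeasure_sub,
    Measure.jordanDecompositionOfToSignedMeasureSub_posPart,
    Measure.jordanDecompositionOfToSignedMeasureSub_negPart]
  have h1 : Integrable g (p - q) := hp.mono_measure Measure.sub_le
  have h2 : Integrable g (q - p) := hq.mono_measure Measure.sub_le
  have key : (p - q) + q = (q - p) + p := by
    have := Measure.sub_toSignedMeasure_eq_toSignedMeasure_sub (μ := p) (ν := q)
    rw [← Measure.toSignedMeasure_eq_toSignedMeasure_iff]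
    rw [Measure.toSignedMeasure_add, Measure.toSignedMeasure_add]
    rw [sub_eq_sub_iff_add_eq_add] at this
    rw [← this, add_comm]
  have e : ∫ x, g x ∂((p - q) + q) = ∫ x, g x ∂((q - p) + p) := by rw [key]
  rw [integral_add_measure h1 hq, integral_add_measure h2 hp] at e
  linarith

theorem aux_tv {A : Type*} [MeasurableSpace A] (p q : Measure A)
    [IsFiniteMeasure p] [IsFiniteMeasure q] :
    (p.toSignedMeasure - q.toSignedMeasure).totalVariation Set.univ
      ≤ p Set.univ + q Set.univ := by
  unfold SignedMeasure.totalVariation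
  rw [Measure.toJordanDecomposition_toSignedMeasure_sub,
    Measure.jordanDecompositionOfToSignedMeasureSub_posPart,
    Measure.jordanDecompositionOfToSignedMeasureSub_negPart, Measure.add_apply]
  exact add_le_add (Measure.sub_le _) (Measure.sub_le _)

/-- The positive atomic measure. -/
noncomputable def auxAtom {A : Type*} [MeasurableSpace A] {ι : Type*} [Fintype ι]
    (w : ι → ℝ) (a : ι → A) : Measure A :=
  ∑ i, (w i).toNNReal • Measure.dirac (a i)

instance auxAtom_finite {A : Type*} [MeasurableSpace A] {ι : Type*} [Fintype ι]
    (w : ι → ℝ) (a : ι → A) : IsFiniteMeasure (auxAtom w a) := by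
  unfold auxAtom; infer_instance

theorem auxAtom_integrable {A : Type*} [MeasurableSpace A] {ι : Type*} [Fintype ι]
    (w : ι → ℝ) (a : ι → A) (g : A → ℝ) (hg : StronglyMeasurable g) :
    Integrable g (auxAtom w a) := by
  unfold auxAtom
  rw [integrable_finsetSum_measure]
  intro i _
  apply Integrable.smul_measure_nnreal
  exact integrable_dirac' hg (by simp)

theorem auxAtom_integral {A : Type*} [MeasurableSpace A] {ι : Type*} [Fintype ι]
    (w : ι → ℝ) (a : ι → A) (g : A → ℝ) (hg : StronglyMeasurable g) :
    ∫ x, g x ∂(auxAtom w a) = ∑ i, max (w i) 0 * g (a i) := by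
  unfold auxAtom
  rw [integral_finsetSum_measure]
  · refine Finset.sum_congr rfl fun i _ => ?_
    rw [integral_smul_nnreal_measure, integral_dirac' _ _ hg]
    simp [NNReal.smul_def]
  · intro i _
    apply Integrable.smul_measure_nnreal
    exact integrable_dirac' hg (by simp)

theorem auxAtom_univ {A : Type*} [MeasurableSpace A] {ι : Type*} [Fintype ι]
    (w : ι → ℝ) (a : ι → A) :
    (auxAtom w a) Set.univ = ENNReal.ofReal (∑ i, max (w i) 0) := by
  unfold auxAtom
  rw [ENNReal.ofReal_sum_of_nonneg (fun i _ => le_max_right _ _)]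
  simp [Measure.finsetSum_apply]
  rfl

theorem aux_rep {A : Type*} [MeasurableSpace A] {ι : Type*} [Fintype ι]
    (w : ι → ℝ) (a : ι → A) (μ : Measure A) [IsFiniteMeasure μ] :
    (∑ i, w i • (Measure.dirac (a i)).toSignedMeasure) - μ.toSignedMeasure
      = (auxAtom w a).toSignedMeasure - (auxAtom (fun i => - w i) a + μ).toSignedMeasure := by
  have hs : ∀ v : ι → ℝ, (auxAtom v a).toSignedMeasure
      = ∑ i, max (v i) 0 • (Measure.dirac (a i)).toSignedMeasure := by
    intro v
    ext s hs
    rw [Measure.toSignedMeasure_apply_measurable hs]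
    have : (auxAtom v a).real s = ∑ i, max (v i) 0 * (Measure.dirac (a i)).real s := by
      simp only [measureReal_def, auxAtom, Measure.finsetSum_apply]
      rw [ENNReal.toReal_sum]
      · refine Finset.sum_congr rfl fun i _ => ?_
        rw [Measure.smul_apply, ENNReal.toReal_smul]
        simp [NNReal.smul_def]
      · intro i _
        exact measure_ne_top _ _
    rw [this]
    have h2 : ∀ t : Finset ι, (∑ i ∈ t, max (v i) 0 • (Measure.dirac (a i)).toSignedMeasure) s
      = ∑ i ∈ t, max (v i) 0 * (Measure.dirac (a i)).real s := by
      classical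
      intro t
      induction t using Finset.induction_on with
      | empty => simp
      | insert b t hb ih =>
        rw [Finset.sum_insert hb, Finset.sum_insert hb, VectorMeasure.add_apply, ih,
          VectorMeasure.smul_apply, Measure.toSignedMeasure_apply_measurable hs, smul_eq_mul]
    rw [h2]
  rw [Measure.toSignedMeasure_add, hs, hs, ← sub_sub, ← Finset.sum_sub_distrib]
  congr 1
  refine Finset.sum_congr rfl fun i _ => ?_
  ext s hs
  simp only [VectorMeasure.sub_apply, VectorMeasure.smul_apply, smul_eq_mul]
  rw [← sub_mul]
  congr 1
  rcases le_total 0 (w i) with h | h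
  · rw [max_eq_left h, max_eq_right (by linarith)]; ring
  · rw [max_eq_right h, max_eq_left (by linarith)]; ring

/-- The explicit functional. -/
noncomputable def auxL {A : Type*} [MeasurableSpace A] {ι : Type*} [Fintype ι]
    (w : ι → ℝ) (a : ι → A) (μ : Measure A) (g : A → ℝ) : ℝ :=
  (∑ i, w i * g (a i)) - ∫ x, g x ∂μ

theorem aux_sint {A : Type*} [MeasurableSpace A] {ι : Type*} [Fintype ι]
    (w : ι → ℝ) (a : ι → A) (μ : Measure A) [IsFiniteMeasure μ] (g : A → ℝ)
    (hg : StronglyMeasurable g) (hi : Integrable g μ) :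
    sintegral ((∑ i, w i • (Measure.dirac (a i)).toSignedMeasure) - μ.toSignedMeasure) g
      = auxL w a μ g := by
  have h1 := auxAtom_integrable w a g hg
  have h2 := auxAtom_integrable (fun i => - w i) a g hg
  rw [aux_rep, aux_sintegral_sub _ _ _ h1 (h2.add_measure hi), integral_add_measure h2 hi,
    auxAtom_integral _ _ _ hg, auxAtom_integral _ _ _ hg, ← sub_sub, ← Finset.sum_sub_distrib]
  unfold auxL
  congr 1
  refine Finset.sum_congr rfl fun i _ => ?_
  rw [← sub_mul]
  congr 1
  rcases le_total 0 (w i) with h | h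
  · rw [max_eq_left h, max_eq_right (by linarith)]; ring
  · rw [max_eq_right h, max_eq_left (by linarith)]; ring

theorem aux_tv_le {A : Type*} [MeasurableSpace A] {ι : Type*} [Fintype ι]
    (w : ι → ℝ) (a : ι → A) (μ : Measure A) [IsProbabilityMeasure μ] (C : ℝ)
    (hC : ∑ i, |w i| ≤ C) :
    ((∑ i, w i • (Measure.dirac (a i)).toSignedMeasure) - μ.toSignedMeasure).totalVariation
      Set.univ ≤ ENNReal.ofReal (C + 1) := by
  rw [aux_rep]
  refine (aux_tv _ _).trans ?_
  rw [Measure.add_apply, auxAtom_univ, auxAtom_univ, measure_univ, ← add_assoc,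
    ← ENNReal.ofReal_one, ← ENNReal.ofReal_add, ← ENNReal.ofReal_add]
  · apply ENNReal.ofReal_le_ofReal
    rw [← Finset.sum_add_distrib]
    have : ∑ i, (max (w i) 0 + max (-w i) 0) = ∑ i, |w i| := by
      refine Finset.sum_congr rfl fun i _ => ?_
      rcases le_total 0 (w i) with h | h
      · rw [max_eq_left h, max_eq_right (by linarith), abs_of_nonneg h]; ring
      · rw [max_eq_right h, max_eq_left (by linarith), abs_of_nonpos h]; ring
    linarith
  · have := Finset.sum_nonneg (fun i (_ : i ∈ Finset.univ) => le_max_right (w i) 0)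
    have := Finset.sum_nonneg (fun i (_ : i ∈ Finset.univ) => le_max_right (- w i) 0)
    linarith
  · norm_num
  · exact Finset.sum_nonneg (fun i _ => le_max_right _ 0)
  · exact Finset.sum_nonneg (fun i _ => le_max_right _ 0)

section cpt

theorem aux_integrable {A : Type*} [MetricSpace A] [CompactSpace A] [MeasurableSpace A]
    [BorelSpace A] (μ : Measure A) [IsFiniteMeasure μ] (g : A → ℝ) (hg : Continuous g) :
    Integrable g μ :=
  hg.integrable_of_hasCompactSupport (HasCompactSupport.of_compactSpace g)

theorem aux_sintc {A : Type*} [MetricSpace A] [CompactSpace A] [MeasurableSpace A]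
    [BorelSpace A] {ι : Type*} [Fintype ι]
    (w : ι → ℝ) (a : ι → A) (μ : Measure A) [IsFiniteMeasure μ] (g : A → ℝ)
    (hg : Continuous g) :
    sintegral ((∑ i, w i • (Measure.dirac (a i)).toSignedMeasure) - μ.toSignedMeasure) g
      = auxL w a μ g :=
  aux_sint w a μ g hg.stronglyMeasurable (aux_integrable μ g hg)

theorem auxL_bound {A : Type*} [MetricSpace A] [CompactSpace A] [MeasurableSpace A]
    [BorelSpace A] {ι : Type*} [Fintype ι]
    (w : ι → ℝ) (a : ι → A) (μ : Measure A) [IsProbabilityMeasure μ] (g : A → ℝ)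
    (C ε : ℝ) (hC : ∑ i, |w i| ≤ C) (he : 0 ≤ ε) (hb : ∀ x, |g x| ≤ ε) :
    |auxL w a μ g| ≤ (C + 1) * ε := by
  unfold auxL
  have h1 : |∑ i, w i * g (a i)| ≤ C * ε := by
    calc |∑ i, w i * g (a i)| ≤ ∑ i, |w i * g (a i)| := Finset.abs_sum_le_sum_abs _ _
      _ ≤ ∑ i, |w i| * ε := by
        refine Finset.sum_le_sum fun i _ => ?_
        rw [abs_mul]
        exact mul_le_mul_of_nonneg_left (hb _) (abs_nonneg _)
      _ = (∑ i, |w i|) * ε := by rw [Finset.sum_mul]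
      _ ≤ C * ε := mul_le_mul_of_nonneg_right hC he
  have h2 : |∫ x, g x ∂μ| ≤ ε := by
    have := norm_integral_le_of_norm_le_const (μ := μ) (f := g) (C := ε)
      (Eventually.of_forall hb)
    simpa using this
  rw [abs_le] at *
  constructor <;> linarith [h1.1, h1.2, h2.1, h2.2]

theorem auxL_sub {A : Type*} [MetricSpace A] [CompactSpace A] [MeasurableSpace A]
    [BorelSpace A] {ι : Type*} [Fintype ι]
    (w : ι → ℝ) (a : ι → A) (μ : Measure A) [IsFiniteMeasure μ] (g h : A → ℝ)
    (hg : Continuous g) (hh : Continuous h) :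
    auxL w a μ (fun x => g x - h x) = auxL w a μ g - auxL w a μ h := by
  unfold auxL
  rw [integral_sub (aux_integrable μ g hg) (aux_integrable μ h hh)]
  simp only [mul_sub, Finset.sum_sub_distrib]
  ring

theorem auxL_cont {A T : Type*} [MetricSpace A] [CompactSpace A] [MeasurableSpace A]
    [BorelSpace A] [MetricSpace T] [CompactSpace T] {ι : Type*} [Fintype ι]
    (w : ι → ℝ) (a : ι → A) (μ : Measure A) [IsFiniteMeasure μ] (k : T × A → ℝ)
    (hk : Continuous k) : Continuous fun t => auxL w a μ fun x => k (t, x) := by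
  unfold auxL
  refine Continuous.sub (by fun_prop) ?_
  have := continuous_parametric_integral_of_continuous (μ := μ) (f := fun t x => k (t, x))
    (by simpa [Function.uncurry_def] using hk) (isCompact_univ)
  simpa using this

theorem aux_unif {A T : Type*} [MetricSpace A] [CompactSpace A] [MeasurableSpace A]
    [BorelSpace A] [MetricSpace T] [CompactSpace T] {ι : ℕ → Type*} [∀ n, Fintype (ι n)]
    (w : ∀ n, ι n → ℝ) (a : ∀ n, ι n → A) (μ : Measure A) [IsProbabilityMeasure μ]
    (C : ℝ) (hC : ∀ n, ∑ i, |w n i| ≤ C)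
    (hL : ∀ g : A → ℝ, Continuous g → Tendsto (fun n => auxL (w n) (a n) μ g) atTop (𝓝 0))
    (k : T × A → ℝ) (hk : Continuous k) (ε : ℝ) (he : 0 < ε) :
    ∀ᶠ n in atTop, ∀ t, |auxL (w n) (a n) μ fun x => k (t, x)| ≤ ε := by
  have hC0 : 0 ≤ C := (Finset.sum_nonneg fun i _ => abs_nonneg _).trans (hC 0)
  have hkc : ∀ t, Continuous fun x => k (t, x) := fun t => by fun_prop
  have main : ∀ᶠ n in atTop, ∀ t ∈ (Set.univ : Set T),
      |auxL (w n) (a n) μ fun x => k (t, x)| ≤ ε := by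
    refine isCompact_univ.induction_on
      (p := fun s : Set T => ∀ᶠ n in atTop, ∀ t ∈ s,
        |auxL (w n) (a n) μ fun x => k (t, x)| ≤ ε) ?_ ?_ ?_ ?_
    · simp
    · intro s t hst h
      filter_upwards [h] with n hn x hx using hn x (hst hx)
    · intro s t h1 h2
      filter_upwards [h1, h2] with n hn1 hn2 x hx
      exact hx.elim (hn1 x) (hn2 x)
    · intro t _
      let K : C(T, C(A, ℝ)) := ContinuousMap.curry ⟨k, hk⟩
      set δ := ε / (2 * (C + 1)) with hδ
      have hδ0 : 0 < δ := by positivity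
      refine ⟨K ⁻¹' Metric.ball (K t) δ,
        mem_nhdsWithin_of_mem_nhds (K.continuous.continuousAt (Metric.ball_mem_nhds _ hδ0)), ?_⟩
      have h1 := (hL _ (hkc t)).eventually (Metric.ball_mem_nhds 0 (half_pos he))
      filter_upwards [h1] with n hn s hs
      have hb : ∀ x, |k (s, x) - k (t, x)| ≤ δ := by
        intro x
        have := ContinuousMap.dist_lt_iff hδ0 |>.1 (Metric.mem_ball.1 hs) x
        rw [Real.dist_eq] at this
        exact this.le
      have h2 := auxL_bound (w n) (a n) μ _ C δ (hC n) hδ0.le hb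
      rw [auxL_sub _ _ _ _ _ (hkc s) (hkc t)] at h2
      have h3 : (C + 1) * δ = ε / 2 := by rw [hδ]; field_simp
      rw [h3] at h2
      have h4 : |auxL (w n) (a n) μ fun x => k (t, x)| < ε / 2 := by
        simpa [Real.dist_eq] using hn
      rw [abs_le] at *
      rw [abs_lt] at h4
      constructor <;> linarith [h2.1, h2.2, h4.1, h4.2]
  filter_upwards [main] with n hn t using hn t trivial

theorem aux_energy {A : Type*} [MetricSpace A] [CompactSpace A] [MeasurableSpace A]
    [BorelSpace A] {ι : Type*} [Fintype ι]
    (w : ι → ℝ) (a : ι → A) (μ : Measure A) [IsFiniteMeasure μ] (k : A × A → ℝ)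
    (hk : Continuous k) :
    energy k ((∑ i, w i • (Measure.dirac (a i)).toSignedMeasure) - μ.toSignedMeasure)
      = auxL w a μ fun s => auxL w a μ fun t => k (s, t) := by
  unfold energy
  have : (fun s => sintegral ((∑ i, w i • (Measure.dirac (a i)).toSignedMeasure)
      - μ.toSignedMeasure) fun t => k (s, t)) = fun s => auxL w a μ fun t => k (s, t) := by
    funext s
    exact aux_sintc _ _ _ _ (by fun_prop)
  rw [this]
  exact aux_sintc _ _ _ _ (auxL_cont _ _ _ _ hk)

theorem auxL_map {A B : Type*} [MetricSpace A] [CompactSpace A] [MeasurableSpace A]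
    [BorelSpace A] [MetricSpace B] [CompactSpace B] [MeasurableSpace B] [BorelSpace B]
    {ι : Type*} [Fintype ι]
    (w : ι → ℝ) (a : ι → A) (μ : Measure A) (φ : A → B) (hφ : Continuous φ) (g : B → ℝ)
    (hg : Continuous g) :
    auxL w (fun i => φ (a i)) (μ.map φ) g = auxL w a μ fun x => g (φ x) := by
  unfold auxL
  rw [integral_map hφ.measurable.aemeasurable hg.aestronglyMeasurable]

theorem auxL_mul {A : Type*} [MeasurableSpace A]
    {ι : Type*} [Fintype ι]
    (w : ι → ℝ) (a : ι → A) (μ : Measure A) (g : A → ℝ) (c : ℝ) :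
    auxL w a μ (fun x => g x * c) = auxL w a μ g * c := by
  unfold auxL
  rw [integral_mul_const, sub_mul, Finset.sum_mul]
  simp only [mul_assoc]

/-- weak convergence of one factor, by embedding into the product -/
theorem aux_weak {A B : Type*} [MetricSpace A] [CompactSpace A] [MeasurableSpace A]
    [BorelSpace A] [MetricSpace B] [CompactSpace B] [MeasurableSpace B] [BorelSpace B]
    (k : A × A → ℝ) (hk : Continuous k) (kk : B × B → ℝ) (hkk : Continuous kk)
    (φ : A → B) (hφ : Continuous φ) (π : B → A) (hπ : Continuous π) (hπφ : ∀ a, π (φ a) = a)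
    (c : ℝ) (hc : ∀ a b, kk (φ a, φ b) = k (a, b) * c)
    (huniv : ∀ C' > (0 : ℝ), ∀ ρ : ℕ → SignedMeasure B,
      (∀ n, (ρ n).totalVariation Set.univ ≤ ENNReal.ofReal C') →
      Tendsto (fun n => energy kk (ρ n)) atTop (𝓝 0) →
      ∀ g : B → ℝ, Continuous g →
        Tendsto (fun n => sintegral (ρ n) g) atTop (𝓝 0))
    {ι : ℕ → Type*} [∀ n, Fintype (ι n)]
    (w : ∀ n, ι n → ℝ) (a : ∀ n, ι n → A) (μ : Measure A) [IsProbabilityMeasure μ]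
    (C : ℝ) (hC : ∀ n, ∑ i, |w n i| ≤ C)
    (hE : Tendsto (fun n => energy k ((∑ i, w n i • (Measure.dirac (a n i)).toSignedMeasure)
      - μ.toSignedMeasure)) atTop (𝓝 0))
    (g : A → ℝ) (hg : Continuous g) :
    Tendsto (fun n => auxL (w n) (a n) μ g) atTop (𝓝 0) := by
  have hC0 : 0 ≤ C := (Finset.sum_nonneg fun i _ => abs_nonneg _).trans (hC 0)
  haveI : IsProbabilityMeasure (μ.map φ) :=
    Measure.isProbabilityMeasure_map hφ.measurable.aemeasurable
  have := huniv (C + 1) (by linarith)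
    (fun n => (∑ i, w n i • (Measure.dirac (φ (a n i))).toSignedMeasure)
      - (μ.map φ).toSignedMeasure)
    (fun n => aux_tv_le (w n) (fun i => φ (a n i)) (μ.map φ) C (hC n)) ?_
    (fun b => g (π b)) (by fun_prop)
  · refine this.congr fun n => ?_
    rw [aux_sintc (w n) (fun i => φ (a n i)) _ _ (by fun_prop),
      auxL_map _ _ _ _ hφ _ (by fun_prop)]
    simp only [hπφ]
  · have h2 := hE.mul_const c
    rw [zero_mul] at h2
    refine h2.congr fun n => ?_
    rw [aux_energy _ _ _ _ hk, aux_energy (w n) (fun i => φ (a n i)) _ _ hkk,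
      auxL_map _ _ _ _ hφ _ (auxL_cont _ _ _ _ hkk)]
    rw [← auxL_mul]
    congr 1
    funext s
    rw [auxL_map _ _ _ _ hφ _ (by fun_prop), ← auxL_mul]
    simp only [hc]

end cpt

/-- Consistency of the estimator `μ̂₃` of Section 3.1 of the paper: if the weighted-sample
estimators of the mean embeddings of two independent random variables `X ∼ P` and
`Y ∼ Q` are consistent (their error energies tend to 0), and the product kernel
`k_xy = k_x · k_y` has the `c₀`-universality-type property that energy convergence of
uniformly TV-bounded signed measures implies weak convergence, then the error energy of
`μ̂₃ = Σ_{i,j} w_i u_j k_z(f(x_i,y_j),·)`, i.e. the `k_z`-energy of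
`ρ_n = Σ_{i,j} w_{n,i} u_{n,j} δ_{f(x_{n,i},y_{n,j})} − f_*(P ⊗ Q)`, tends to 0. -/
theorem consistency_of_two_variable_estimator
    {X Y Z : Type*}
    [MetricSpace X] [CompactSpace X] [MeasurableSpace X] [BorelSpace X]
    [MetricSpace Y] [CompactSpace Y] [MeasurableSpace Y] [BorelSpace Y]
    [MetricSpace Z] [CompactSpace Z] [MeasurableSpace Z] [BorelSpace Z]
    (f : X × Y → Z) (hf : Continuous f)
    (kz : Z × Z → ℝ) (hkz_cont : Continuous kz)
    (hkz_symm : ∀ z z', kz (z, z') = kz (z', z))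
    (kx : X × X → ℝ) (hkx_bdd : ∃ M, ∀ p, |kx p| ≤ M) (hkx_cont : Continuous kx)
    (hkx_symm : ∀ a b, kx (a, b) = kx (b, a))
    (hkx_psd : ∀ (m : ℕ) (x : Fin m → X) (c : Fin m → ℝ),
      0 ≤ ∑ i, ∑ j, c i * c j * kx (x i, x j))
    (ky : Y × Y → ℝ) (hky_bdd : ∃ M, ∀ p, |ky p| ≤ M) (hky_cont : Continuous ky)
    (hky_symm : ∀ a b, ky (a, b) = ky (b, a))
    (hky_psd : ∀ (m : ℕ) (y : Fin m → Y) (c : Fin m → ℝ),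
      0 ≤ ∑ i, ∑ j, c i * c j * ky (y i, y j))
    (kxy : (X × Y) × (X × Y) → ℝ)
    (hkxy : ∀ p q : X × Y, kxy (p, q) = kx (p.1, q.1) * ky (p.2, q.2))
    (hkxy_univ : ∀ C' > (0 : ℝ), ∀ ρ : ℕ → SignedMeasure (X × Y),
      (∀ n, (ρ n).totalVariation Set.univ ≤ ENNReal.ofReal C') →
      Tendsto (fun n => energy kxy (ρ n)) atTop (𝓝 0) →
      ∀ g : X × Y → ℝ, Continuous g →
        Tendsto (fun n => sintegral (ρ n) g) atTop (𝓝 0))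
    (P : Measure X) [IsProbabilityMeasure P] (Q : Measure Y) [IsProbabilityMeasure Q]
    (C : ℝ) (m : ℕ → ℕ)
    (x : (n : ℕ) → Fin (m n) → X) (w : (n : ℕ) → Fin (m n) → ℝ)
    (y : (n : ℕ) → Fin (m n) → Y) (u : (n : ℕ) → Fin (m n) → ℝ)
    (hw : ∀ n, ∑ i, |w n i| ≤ C) (hu : ∀ n, ∑ j, |u n j| ≤ C)
    (Phat : ℕ → SignedMeasure X) (Qhat : ℕ → SignedMeasure Y)
    (hPhat : ∀ n, Phat n = ∑ i, w n i • (Measure.dirac (x n i)).toSignedMeasure)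
    (hQhat : ∀ n, Qhat n = ∑ j, u n j • (Measure.dirac (y n j)).toSignedMeasure)
    (ρ : ℕ → SignedMeasure Z)
    (hρ : ∀ n, ρ n =
      (∑ i, ∑ j, (w n i * u n j) • (Measure.dirac (f (x n i, y n j))).toSignedMeasure)
        - ((P.prod Q).toSignedMeasure.map f))
    (hPconv : Tendsto (fun n => energy kx (Phat n - P.toSignedMeasure)) atTop (𝓝 0))
    (hQconv : Tendsto (fun n => energy ky (Qhat n - Q.toSignedMeasure)) atTop (𝓝 0)) :
    Tendsto (fun n => energy kz (ρ n)) atTop (𝓝 0) := by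
  obtain ⟨x0⟩ : Nonempty X := nonempty_of_isProbabilityMeasure P
  obtain ⟨y0⟩ : Nonempty Y := nonempty_of_isProbabilityMeasure Q
  have hC0 : 0 ≤ C := (Finset.sum_nonneg fun i _ => abs_nonneg _).trans (hw 0)
  have hkk : Continuous kxy := by
    have : kxy = fun p => kx (p.1.1, p.2.1) * ky (p.1.2, p.2.2) := by
      funext p; exact hkxy p.1 p.2
    rw [this]; fun_prop
  have hP : ∀ g : X → ℝ, Continuous g →
      Tendsto (fun n => auxL (w n) (x n) P g) atTop (𝓝 0) := by
    refine aux_weak kx hkx_cont kxy hkk (fun a => (a, y0)) (by fun_prop) Prod.fst (by fun_prop)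
      (fun a => rfl) (ky (y0, y0)) (fun a b => hkxy _ _) hkxy_univ w x P C hw ?_
    simpa only [hPhat] using hPconv
  have hQ : ∀ g : Y → ℝ, Continuous g →
      Tendsto (fun n => auxL (u n) (y n) Q g) atTop (𝓝 0) := by
    refine aux_weak ky hky_cont kxy hkk (fun b => (x0, b)) (by fun_prop) Prod.snd (by fun_prop)
      (fun a => rfl) (kx (x0, x0)) (fun a b => by rw [hkxy, mul_comm]) hkxy_univ u y Q C hu ?_
    simpa only [hQhat] using hQconv
  -- joint functional
  let W : ∀ n, Fin (m n) × Fin (m n) → ℝ := fun n p => w n p.1 * u n p.2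
  let S : ∀ n, Fin (m n) × Fin (m n) → Z := fun n p => f (x n p.1, y n p.2)
  haveI : IsProbabilityMeasure ((P.prod Q).map f) :=
    Measure.isProbabilityMeasure_map hf.measurable.aemeasurable
  have hW : ∀ n, ∑ p, |W n p| ≤ C * C := by
    intro n
    have : ∑ p, |W n p| = (∑ i, |w n i|) * ∑ j, |u n j| := by
      rw [Fintype.sum_prod_type, Finset.sum_mul_sum]
      simp only [W, abs_mul]
    rw [this]
    exact mul_le_mul (hw n) (hu n) (Finset.sum_nonneg fun i _ => abs_nonneg _) hC0
  have hρ' : ∀ n, ρ n = (∑ p, W n p • (Measure.dirac (S n p)).toSignedMeasure)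
      - ((P.prod Q).map f).toSignedMeasure := by
    intro n
    rw [hρ, Fintype.sum_prod_type]
    congr 1
    ext s hs
    rw [VectorMeasure.map_apply _ hf.measurable hs,
      Measure.toSignedMeasure_apply_measurable hs,
      Measure.toSignedMeasure_apply_measurable (hf.measurable hs),
      measureReal_def, measureReal_def, Measure.map_apply hf.measurable hs]
  have hR : ∀ g : Z → ℝ, Continuous g →
      Tendsto (fun n => auxL (W n) (S n) ((P.prod Q).map f) g) atTop (𝓝 0) := by
    intro g hg
    have hdec : ∀ n, auxL (W n) (S n) ((P.prod Q).map f) g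
        = (∑ i, w n i * auxL (u n) (y n) Q fun b => g (f (x n i, b)))
          + auxL (w n) (x n) P fun a => ∫ b, g (f (a, b)) ∂Q := by
      intro n
      have hI := integral_prod (μ := P) (ν := Q) (fun p => g (f p))
        (aux_integrable _ _ (by fun_prop))
      unfold auxL
      rw [integral_map hf.measurable.aemeasurable hg.aestronglyMeasurable, hI,
        Fintype.sum_prod_type]
      simp only [W, S, mul_sub, Finset.sum_sub_distrib, Finset.mul_sum, mul_assoc]
      ring
    have hcQ : Continuous fun a => ∫ b, g (f (a, b)) ∂Q := by
      have := continuous_parametric_integral_of_continuous (μ := Q)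
        (f := fun a b => g (f (a, b))) (hg.comp hf)
        (isCompact_univ)
      simpa using this
    simp only [hdec]
    rw [← add_zero (0 : ℝ)]
    refine Tendsto.add ?_ (hP _ hcQ)
    rw [Metric.tendsto_nhds]
    intro ε he
    have hδ0 : 0 < ε / (C + 1) := by positivity
    filter_upwards [aux_unif u y Q C hu hQ (fun p : X × Y => g (f p)) (by fun_prop) _ hδ0]
      with n hn
    rw [Real.dist_eq, sub_zero]
    calc _ ≤ ∑ i, |w n i * auxL (u n) (y n) Q fun b => g (f (x n i, b))| :=
          Finset.abs_sum_le_sum_abs _ _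
      _ ≤ ∑ i, |w n i| * (ε / (C + 1)) := by
        refine Finset.sum_le_sum fun i _ => ?_
        rw [abs_mul]
        exact mul_le_mul_of_nonneg_left (hn _) (abs_nonneg _)
      _ = (∑ i, |w n i|) * (ε / (C + 1)) := by rw [Finset.sum_mul]
      _ ≤ C * (ε / (C + 1)) := mul_le_mul_of_nonneg_right (hw n) hδ0.le
      _ < (C + 1) * (ε / (C + 1)) := mul_lt_mul_of_pos_right (by linarith) hδ0
      _ = ε := by field_simp
  rw [Metric.tendsto_nhds]
  intro ε he
  have hδ0 : 0 < ε / (2 * (C * C + 1)) := by positivity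
  filter_upwards [aux_unif W S ((P.prod Q).map f) (C * C) hW hR kz hkz_cont _ hδ0] with n hn
  rw [Real.dist_eq, sub_zero, hρ', aux_energy _ _ _ _ hkz_cont]
  have := auxL_bound (W n) (S n) ((P.prod Q).map f) _ (C * C) _ (hW n) hδ0.le hn
  refine this.trans_lt ?_
  have h3 : (C * C + 1) * (ε / (2 * (C * C + 1))) = ε / 2 := by
    have : C * C + 1 ≠ 0 := by positivity
    field_simp
  rw [h3]; linarith
end
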